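/- arXiv:1803.10441 — 4 statements merged into one kernel-verified Lean document; each statement's English description precedes it below -/
import Mathlib

section
/- Let F : ℝ^d → ℝ^d be η-strongly monotone and ℓ-Lipschitz continuous (η, ℓ > 0), A ∈ ℝ^{m×d}, b ∈ ℝ^m, 𝛂 a positive diagonal d×d matrix with largest entry α_max, and γ > 0 with γ < 1/(‖A‖²·α_max), so that Φ_s := [[𝛂⁻¹, −Aᵀ], [−A, γ⁻¹I_m]] is positive definite. Define 𝒜(x,λ) := (F(x), b) and β := (η/ℓ²)·λ_min(𝛂⁻¹ − γAᵀA), where λ_min denotes the smallest eigenvalue. Then Φ_s⁻¹𝒜 is β-cocoercive with respect to the Φ_s-inner product; equivalently, for all ω₁ = (x₁,λ₁), ω₂ = (x₂,λ₂) ∈ ℝ^d × ℝ^m, ⟨𝒜(ω₁) − 𝒜(ω₂), ω₁ − ω₂⟩ ≥ β · (𝒜(ω₁) − 𝒜(ω₂))ᵀ Φ_s⁻¹ (𝒜(ω₁) − 𝒜(ω₂)). -/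
open scoped RealInnerProductSpace
open Matrix

/-- The maximum singular value (Euclidean operator norm) of a matrix. -/
noncomputable def opNorm {I J : Type*} [Fintype I] [Fintype J] [DecidableEq J]
    (A : Matrix I J ℝ) : ℝ :=
  ‖LinearMap.toContinuousLinearMap (Matrix.toEuclideanLin A)‖

/-- The smallest eigenvalue of a real symmetric matrix bounds its quadratic form from below. -/
lemma Matrix.IsHermitian.iInf_eigenvalues_mul_le {n : Type*} [Fintype n] [DecidableEq n]
    {M : Matrix n n ℝ} (hM : M.IsHermitian) (p : n → ℝ) :
    (⨅ i, hM.eigenvalues i) * (p ⬝ᵥ p) ≤ p ⬝ᵥ (M *ᵥ p) := by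
  set c := ⨅ i, hM.eigenvalues i with hc
  have hdiag : (diagonal fun i => hM.eigenvalues i - c).PosSemidef := by
    rw [posSemidef_diagonal_iff]
    exact fun i => sub_nonneg.2 (ciInf_le (Set.finite_range _).bddBelow i)
  have hshift : (M - c • (1 : Matrix n n ℝ)).PosSemidef := by
    have key := hdiag.mul_mul_conjTranspose_same (hM.eigenvectorUnitary : Matrix n n ℝ)
    have hD : (diagonal fun i => hM.eigenvalues i - c) =
        diagonal hM.eigenvalues - c • (1 : Matrix n n ℝ) := by
      rw [smul_one_eq_diagonal, diagonal_sub]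
    have hU : (hM.eigenvectorUnitary : Matrix n n ℝ) *
        (hM.eigenvectorUnitary : Matrix n n ℝ)ᴴ = 1 :=
      Unitary.coe_mul_star_self hM.eigenvectorUnitary
    have hspec : (hM.eigenvectorUnitary : Matrix n n ℝ) * diagonal hM.eigenvalues *
        (hM.eigenvectorUnitary : Matrix n n ℝ)ᴴ = M := by
      conv_rhs => rw [hM.spectral_theorem, Unitary.conjStarAlgAut_apply]
      rfl
    rwa [hD, mul_sub, sub_mul, hspec, mul_smul_comm, smul_mul_assoc, mul_one, hU] at key
  have := hshift.dotProduct_mulVec_nonneg p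
  rw [star_trivial, sub_mulVec, dotProduct_sub, smul_mulVec, one_mulVec, dotProduct_smul,
    smul_eq_mul] at this
  linarith

/-- If the quadratic form of a real symmetric matrix `M` is nonnegative at `p`, then it is
dominated by `‖M p‖²` after multiplication by the smallest eigenvalue of `M`. -/
lemma Matrix.IsHermitian.iInf_eigenvalues_mul_dotProduct_mulVec_le {n : Type*} [Fintype n]
    [DecidableEq n] {M : Matrix n n ℝ} (hM : M.IsHermitian) {p : n → ℝ}
    (hp : 0 ≤ p ⬝ᵥ (M *ᵥ p)) :
    (⨅ i, hM.eigenvalues i) * (p ⬝ᵥ (M *ᵥ p)) ≤ (M *ᵥ p) ⬝ᵥ (M *ᵥ p) := by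
  have hlow := hM.iInf_eigenvalues_mul_le p
  have hcs : (p ⬝ᵥ (M *ᵥ p)) ^ 2 ≤ (p ⬝ᵥ p) * ((M *ᵥ p) ⬝ᵥ (M *ᵥ p)) := by
    simpa only [dotProduct, sq] using
      Finset.sum_mul_sq_le_sq_mul_sq Finset.univ p (M *ᵥ p)
  have hnn : 0 ≤ (M *ᵥ p) ⬝ᵥ (M *ᵥ p) := by
    simpa using dotProduct_star_self_nonneg (M *ᵥ p)
  generalize (⨅ i, hM.eigenvalues i) = c at *
  generalize p ⬝ᵥ (M *ᵥ p) = s at *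
  generalize (M *ᵥ p) ⬝ᵥ (M *ᵥ p) = g at *
  rcases le_total c 0 with hc | hc
  · exact (mul_nonpos_of_nonpos_of_nonneg hc hp).trans hnn
  rcases hp.eq_or_lt with rfl | hs
  · simpa using hnn
  refine le_of_mul_le_mul_right ?_ hs
  calc c * s * s = c * s ^ 2 := by ring
    _ ≤ c * ((p ⬝ᵥ p) * g) := by gcongr
    _ = c * (p ⬝ᵥ p) * g := by ring
    _ ≤ s * g := by gcongr
    _ = g * s := mul_comm _ _

/-- Solving a block system with right-hand side supported on the first block reduces to the
Schur complement of the second diagonal block. -/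
lemma schur_mulVec_of_fromBlocks_mulVec {I J : Type*} [Fintype I] [Fintype J]
    [DecidableEq J] {P : Matrix I I ℝ} {A : Matrix J I ℝ} {γ : ℝ} (hγ : γ ≠ 0)
    {w : I ⊕ J → ℝ} {g : I → ℝ}
    (h : fromBlocks P (-Aᵀ) (-A) (γ⁻¹ • (1 : Matrix J J ℝ)) *ᵥ w = Sum.elim g 0) :
    (P - γ • (Aᵀ * A)) *ᵥ (w ∘ Sum.inl) = g := by
  rw [fromBlocks_mulVec, Sum.elim_eq_iff] at h
  obtain ⟨h₁, h₂⟩ := h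
  have hq : w ∘ Sum.inr = γ • (A *ᵥ (w ∘ Sum.inl)) := by
    rw [neg_mulVec, smul_mulVec, one_mulVec, neg_add_eq_zero] at h₂
    rw [h₂, smul_smul, mul_inv_cancel₀ hγ, one_smul]
  rw [← h₁, hq, sub_mulVec, smul_mulVec, ← mulVec_mulVec, neg_mulVec, mulVec_smul, sub_eq_add_neg]

/-- the preconditioned forward map `Φ_s⁻¹𝒜` is β-cocoercive with respect
to the `Φ_s`-inner product, with `β = (η/ℓ²)·λ_min(𝛂⁻¹ − γAᵀA)`; equivalently,
`⟨𝒜(ω₁) − 𝒜(ω₂), ω₁ − ω₂⟩ ≥ β (𝒜(ω₁) − 𝒜(ω₂))ᵀ Φ_s⁻¹ (𝒜(ω₁) − 𝒜(ω₂))`. -/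
theorem preconditioned_forward_cocoercive
    (d m : ℕ) (F : EuclideanSpace ℝ (Fin d) → EuclideanSpace ℝ (Fin d))
    (η ℓ : ℝ) (hη : 0 < η) (hℓ : 0 < ℓ)
    (hmono : ∀ x y, ⟪F x - F y, x - y⟫ ≥ η * ‖x - y‖ ^ 2)
    (hlip : ∀ x y, ‖F x - F y‖ ≤ ℓ * ‖x - y‖)
    (A : Matrix (Fin m) (Fin d) ℝ) (b : EuclideanSpace ℝ (Fin m))
    (α : Fin d → ℝ) (hα : ∀ i, 0 < α i)
    (αmax : ℝ) (hαmax : IsGreatest (Set.range α) αmax)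
    (γ : ℝ) (hγ : 0 < γ) (hstep : γ < 1 / (opNorm A ^ 2 * αmax))
    (Φs : Matrix (Fin d ⊕ Fin m) (Fin d ⊕ Fin m) ℝ)
    (hΦs : Φs = Matrix.fromBlocks (Matrix.diagonal α)⁻¹ (-Aᵀ) (-A)
      (γ⁻¹ • (1 : Matrix (Fin m) (Fin m) ℝ)))
    (hΦpd : Φs.PosDef)
    (hM : ((Matrix.diagonal α)⁻¹ - γ • (Aᵀ * A)).IsHermitian)
    (β : ℝ) (hβ : β = η / ℓ ^ 2 * ⨅ i, hM.eigenvalues i) :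
    ∀ (x₁ x₂ : EuclideanSpace ℝ (Fin d)) (lam₁ lam₂ : EuclideanSpace ℝ (Fin m)),
      ⟪F x₁ - F x₂, x₁ - x₂⟫ + ⟪b - b, lam₁ - lam₂⟫ ≥
        β * ((Sum.elim (F x₁ - F x₂) (b - b)) ⬝ᵥ
          (Φs⁻¹.mulVec (Sum.elim (F x₁ - F x₂) (b - b)))) := by
  intro x₁ x₂ lam₁ lam₂
  set g := F x₁ - F x₂ with hg
  have hv₁ : Sum.elim (g : Fin d → ℝ) ((b - b : EuclideanSpace ℝ (Fin m)) : Fin m → ℝ) =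
      Sum.elim (g : Fin d → ℝ) 0 := by
    simp
  have hv₂ : Sum.elim ((F x₁).ofLp - (F x₂).ofLp) (b.ofLp - b.ofLp) =
      Sum.elim (g : Fin d → ℝ) 0 := by
    simp [hg]
  rw [hv₁, hv₂, sub_self b, inner_zero_left, add_zero]
  set w := Φs⁻¹ *ᵥ Sum.elim (g : Fin d → ℝ) 0 with hw
  have hΦw : Φs *ᵥ w = Sum.elim (g : Fin d → ℝ) 0 := by
    rw [hw, mulVec_mulVec, mul_nonsing_inv _ ((isUnit_iff_isUnit_det _).1 hΦpd.isUnit), one_mulVec]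
  have hMp := schur_mulVec_of_fromBlocks_mulVec hγ.ne' (hΦs ▸ hΦw)
  have hs : Sum.elim (g : Fin d → ℝ) 0 ⬝ᵥ w = (w ∘ Sum.inl) ⬝ᵥ (g : Fin d → ℝ) := by
    rw [dotProduct_comm]
    simp [dotProduct]
  have hs_nonneg : 0 ≤ (w ∘ Sum.inl) ⬝ᵥ (g : Fin d → ℝ) := by
    have := hΦpd.posSemidef.dotProduct_mulVec_nonneg w
    rwa [star_trivial, hΦw, dotProduct_comm, hs] at this
  have hbound := hM.iInf_eigenvalues_mul_dotProduct_mulVec_le (hMp.symm ▸ hs_nonneg)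
  rw [hMp] at hbound
  have hgnorm : (g : Fin d → ℝ) ⬝ᵥ (g : Fin d → ℝ) = ‖g‖ ^ 2 := by
    rw [EuclideanSpace.real_norm_sq_eq]
    simp [dotProduct, sq]
  rw [hgnorm] at hbound
  have hlip_sq : ‖g‖ ^ 2 ≤ ℓ ^ 2 * ‖x₁ - x₂‖ ^ 2 := by
    rw [← mul_pow]
    exact pow_le_pow_left₀ (norm_nonneg _) (hlip x₁ x₂) 2
  rw [hs, hβ, ge_iff_le, mul_assoc]
  calc _ ≤ η / ℓ ^ 2 * (ℓ ^ 2 * ‖x₁ - x₂‖ ^ 2) :=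
        mul_le_mul_of_nonneg_left (hbound.trans hlip_sq) (by positivity)
    _ = η * ‖x₁ - x₂‖ ^ 2 := by field_simp
    _ ≤ _ := hmono x₁ x₂
end

section
/- (The asymmetric projection algorithm of Paccagnan et al. coincides with the preconditioned forward-backward step.) Let Ω ⊆ ℝ^d be nonempty closed convex with metric projection P_Ω, F : ℝ^d → ℝ^d, A ∈ ℝ^{m×d}, b ∈ ℝ^m, and let τ > 0 satisfy τ‖A‖ < 1, so that the matrix D := [[τ⁻¹I_d, 0], [−2A, τ⁻¹I_m]] has positive definite symmetric part. Set 𝒞 := Ω × ℝ^m_{≥0} and ℛ(x,λ) := (F(x) + Aᵀλ, b − Ax). Fix ω^k = (x^k, λ^k) ∈ 𝒞 and define ℛ^k_D(ω) := ℛ(ω^k) + D(ω − ω^k). Then the unique solution ω⁺ = (x⁺, λ⁺) ∈ 𝒞 of the variational inequality ⟨ω − ω⁺, ℛ^k_D(ω⁺)⟩ ≥ 0 for all ω ∈ 𝒞 is given by x⁺ = P_Ω( x^k − τ(F(x^k) + Aᵀλ^k) ) and λ⁺ = P_{ℝ^m_{≥0}}( λ^k + τ(2Ax⁺ − Ax^k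 − b) ). -/
open Matrix

/-- A point `p` satisfying the variational characterization of the projection of `a - τ • c`
solves the variational inequality of the forward-backward step. -/
theorem forwardBackward_nonneg {ι : Type*} [Fintype ι] {τ : ℝ} (hτ : 0 < τ) {a c p z : ι → ℝ}
    (h : (a - τ • c - p) ⬝ᵥ (z - p) ≤ 0) : 0 ≤ (z - p) ⬝ᵥ (c + τ⁻¹ • (p - a)) := by
  have key : c + τ⁻¹ • (p - a) = -(τ⁻¹ • (a - τ • c - p)) := by
    ext i
    simp only [Pi.add_apply, Pi.smul_apply, Pi.sub_apply, Pi.neg_apply, smul_eq_mul]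
    field_simp
    ring
  rw [key, dotProduct_neg, dotProduct_smul, dotProduct_comm, smul_eq_mul]
  have := mul_nonpos_of_nonneg_of_nonpos (inv_pos.mpr hτ).le h
  linarith

/-- The solution of the variational inequality of the forward-backward step is unique. -/
theorem forwardBackward_unique {ι : Type*} [Fintype ι] {τ : ℝ} (hτ : 0 < τ) {a c p q : ι → ℝ}
    (hp : 0 ≤ (q - p) ⬝ᵥ (c + τ⁻¹ • (p - a))) (hq : 0 ≤ (p - q) ⬝ᵥ (c + τ⁻¹ • (q - a))) :
    p = q := by
  have key : (q - p) ⬝ᵥ (c + τ⁻¹ • (p - a)) + (p - q) ⬝ᵥ (c + τ⁻¹ • (q - a)) =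
      -(τ⁻¹ * ((p - q) ⬝ᵥ (p - q))) := by
    simp only [dotProduct, Finset.mul_sum, ← Finset.sum_add_distrib, ← Finset.sum_neg_distrib]
    refine Finset.sum_congr rfl fun i _ => ?_
    simp only [Pi.add_apply, Pi.smul_apply, Pi.sub_apply, smul_eq_mul]
    ring
  have hnn : 0 ≤ (p - q) ⬝ᵥ (p - q) := Finset.sum_nonneg fun i _ => mul_self_nonneg _
  have hle : τ⁻¹ * ((p - q) ⬝ᵥ (p - q)) ≤ 0 := by linarith
  have hzero : (p - q) ⬝ᵥ (p - q) = 0 :=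
    le_antisymm (nonpos_of_mul_nonpos_right hle (inv_pos.mpr hτ)) hnn
  exact sub_eq_zero.mp (dotProduct_self_eq_zero.mp hzero)

/-- The variational inequality of the projection onto the nonnegative orthant. -/
theorem sub_max_zero_dotProduct_nonpos {ι : Type*} [Fintype ι] (w z : ι → ℝ)
    (hz : ∀ i, 0 ≤ z i) :
    (w - fun i => max (w i) 0) ⬝ᵥ (z - fun i => max (w i) 0) ≤ 0 := by
  refine Finset.sum_nonpos fun i _ => ?_
  simp only [Pi.sub_apply]
  rcases le_total (w i) 0 with h | h
  · rw [max_eq_right h]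
    nlinarith [hz i]
  · rw [max_eq_left h]
    simp

/-- the asymmetric projection algorithm step, i.e., the unique solution
`ω⁺ = (x⁺, λ⁺) ∈ 𝒞 = Ω × ℝ^m_{≥0}` of the linearized variational inequality
`⟨ω − ω⁺, ℛ(ω^k) + D(ω⁺ − ω^k)⟩ ≥ 0 ∀ ω ∈ 𝒞`, coincides with the preconditioned
forward-backward step. -/
theorem APA_step_is_pFB_step
    (d m : ℕ) (Ω : Set (Fin d → ℝ)) (hΩne : Ω.Nonempty) (hΩc : IsClosed Ω)
    (hΩconv : Convex ℝ Ω)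
    (PΩ : (Fin d → ℝ) → (Fin d → ℝ))
    (hPΩ : ∀ w, PΩ w ∈ Ω ∧ ∀ z ∈ Ω, (w - PΩ w) ⬝ᵥ (z - PΩ w) ≤ 0)
    (F : (Fin d → ℝ) → (Fin d → ℝ)) (A : Matrix (Fin m) (Fin d) ℝ) (b : Fin m → ℝ)
    (τ : ℝ) (hτ : 0 < τ) (hτA : τ * opNorm A < 1)
    (xk : Fin d → ℝ) (lamk : Fin m → ℝ)
    (xp : Fin d → ℝ) (lamp : Fin m → ℝ)
    (hxp : xp = PΩ (xk - τ • (F xk + Aᵀ.mulVec lamk)))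
    (hlamp : lamp = fun i =>
      max ((lamk + τ • (2 • A.mulVec xp - A.mulVec xk - b)) i) 0) :
    -- (x⁺, λ⁺) belongs to 𝒞 and solves the linearized VI ...
    (xp ∈ Ω ∧ (∀ i, 0 ≤ lamp i) ∧
      ∀ y ∈ Ω, ∀ μ : Fin m → ℝ, (∀ i, 0 ≤ μ i) →
        (y - xp) ⬝ᵥ (F xk + Aᵀ.mulVec lamk + τ⁻¹ • (xp - xk)) +
          (μ - lamp) ⬝ᵥ (b - A.mulVec xk
            - 2 • A.mulVec (xp - xk) + τ⁻¹ • (lamp - lamk)) ≥ 0) ∧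
    -- ... and it is the unique such solution
    (∀ x' : Fin d → ℝ, ∀ lam' : Fin m → ℝ,
      x' ∈ Ω → (∀ i, 0 ≤ lam' i) →
      (∀ y ∈ Ω, ∀ μ : Fin m → ℝ, (∀ i, 0 ≤ μ i) →
        (y - x') ⬝ᵥ (F xk + Aᵀ.mulVec lamk + τ⁻¹ • (x' - xk)) +
          (μ - lam') ⬝ᵥ (b - A.mulVec xk
            - 2 • A.mulVec (x' - xk) + τ⁻¹ • (lam' - lamk)) ≥ 0) →
      x' = xp ∧ lam' = lamp) := by
  have hx_mem : xp ∈ Ω := hxp ▸ (hPΩ _).1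
  have hlam_nonneg : ∀ i, 0 ≤ lamp i := fun i => hlamp ▸ le_max_right _ _
  have hx : ∀ y ∈ Ω, 0 ≤ (y - xp) ⬝ᵥ (F xk + Aᵀ.mulVec lamk + τ⁻¹ • (xp - xk)) := by
    intro y hy
    apply forwardBackward_nonneg hτ
    rw [hxp]
    exact (hPΩ _).2 y hy
  have hlam : ∀ μ : Fin m → ℝ, (∀ i, 0 ≤ μ i) → 0 ≤ (μ - lamp) ⬝ᵥ
      (b - A.mulVec xk - 2 • A.mulVec (xp - xk) + τ⁻¹ • (lamp - lamk)) := by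
    intro μ hμ
    apply forwardBackward_nonneg hτ
    have hw : lamk - τ • (b - A.mulVec xk - 2 • A.mulVec (xp - xk)) =
        lamk + τ • (2 • A.mulVec xp - A.mulVec xk - b) := by
      rw [mulVec_sub]
      module
    rw [hw, hlamp]
    exact sub_max_zero_dotProduct_nonpos _ μ hμ
  refine ⟨⟨hx_mem, hlam_nonneg, fun y hy μ hμ => add_nonneg (hx y hy) (hlam μ hμ)⟩, ?_⟩
  intro x' lam' hx' hlam' h
  obtain rfl : x' = xp := by
    refine forwardBackward_unique hτ ?_ (hx x' hx')
    simpa using h xp hx_mem lam' hlam'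
  refine ⟨rfl, forwardBackward_unique hτ ?_ (hlam lam' hlam')⟩
  simpa using h x' hx' lamp hlam_nonneg
end

section
/- (The Koshal–Nedić–Shanbhag algorithm is a preconditioned forward-backward iteration.) Let G be an undirected graph on N vertices with adjacency matrix E, degree matrix D_g := diag(d₁,…,d_N) and Laplacian L := D_g − E; let W := (I_N + D_g)⁻¹(I_N + E), L_n := L ⊗ I_n, P := I_{nN} + E ⊗ I_n. Let 𝛀 ⊆ ℝ^{nN} be a nonempty closed convex product set with metric projection P_𝛀, let F_σ : ℝ^{nN} × ℝ^{nN} → ℝ^{nN}, and let α > 0. Given x^k ∈ 𝛀 and v^k ∈ ℝ^{nN}, set σ^k := (W ⊗ I_n)v^k, x^{k+1} := P_𝛀( x^k − α·F_σ(x^k, σ^k) ), v^{k+1} := (W ⊗ I_n)v^k + x^{k+1} − x^k, and σ^{k+1} := (W ⊗ I_n)v^{k+1}. Then, with 𝒜(x,σ) := (F_σ(x,σ) − ½Pσ, ½Px), ℬ(x,σ) := (N_𝛀(x) + ½Pσ, L_nσ − ½Px), and Φ := [[α⁻¹·I_{nN}, −½P], [−½P, P]], the inclusion −𝒜(x^k,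 σ^k) ∈ ℬ(x^{k+1}, σ^{k+1}) + Φ·((x^{k+1}, σ^{k+1}) − (x^k, σ^k)) holds. -/
open Matrix
open scoped Kronecker

/-- The normal cone of a set `S ⊆ ℝ^k` at a point `x`. -/
def normalCone {k : Type*} [Fintype k] (S : Set (k → ℝ)) (x : k → ℝ) : Set (k → ℝ) :=
  {w | ∀ z ∈ S, w ⬝ᵥ (z - x) ≤ 0}

/-- the Koshal–Nedić–Shanbhag algorithm is a preconditioned
forward-backward iteration: the update satisfies
`−𝒜(x^k, σ^k) ∈ ℬ(x^{k+1}, σ^{k+1}) + Φ((x^{k+1}, σ^{k+1}) − (x^k, σ^k))`. -/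
theorem KNS_algorithm_is_pFB
    (N n : ℕ)
    -- the undirected graph: adjacency matrix E, degree matrix Dg, Laplacian L
    (E : Matrix (Fin N) (Fin N) ℝ) (hEsym : Eᵀ = E)
    (hE01 : ∀ i j, E i j = 0 ∨ E i j = 1) (hEdiag : ∀ i, E i i = 0)
    (Dg : Matrix (Fin N) (Fin N) ℝ) (hDg : Dg = Matrix.diagonal (fun i => ∑ j, E i j))
    (L : Matrix (Fin N) (Fin N) ℝ) (hL : L = Dg - E)
    (W : Matrix (Fin N) (Fin N) ℝ) (hW : W = (1 + Dg)⁻¹ * (1 + E))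
    (Ln : Matrix (Fin N × Fin n) (Fin N × Fin n) ℝ)
    (hLn : Ln = L ⊗ₖ (1 : Matrix (Fin n) (Fin n) ℝ))
    (P : Matrix (Fin N × Fin n) (Fin N × Fin n) ℝ)
    (hP : P = 1 + E ⊗ₖ (1 : Matrix (Fin n) (Fin n) ℝ))
    -- the nonempty closed convex product constraint set and its projection
    (Ωi : Fin N → Set (Fin n → ℝ))
    (hΩi : ∀ i, (Ωi i).Nonempty ∧ IsClosed (Ωi i) ∧ Convex ℝ (Ωi i))
    (Ωbig : Set (Fin N × Fin n → ℝ))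
    (hΩbig : Ωbig = {x | ∀ i, (fun j => x (i, j)) ∈ Ωi i})
    (PΩ : (Fin N × Fin n → ℝ) → (Fin N × Fin n → ℝ))
    (hPΩ : ∀ w, PΩ w ∈ Ωbig ∧ ∀ z ∈ Ωbig, (w - PΩ w) ⬝ᵥ (z - PΩ w) ≤ 0)
    -- the extended pseudo-gradient and the step size
    (Fσ : (Fin N × Fin n → ℝ) → (Fin N × Fin n → ℝ) → (Fin N × Fin n → ℝ))
    (α : ℝ) (hα : 0 < α)
    -- one iteration of the algorithm
    (xk vk : Fin N × Fin n → ℝ) (hxk : xk ∈ Ωbig)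
    (σk : Fin N × Fin n → ℝ) (hσk : σk = (W ⊗ₖ (1 : Matrix (Fin n) (Fin n) ℝ)).mulVec vk)
    (xk1 : Fin N × Fin n → ℝ) (hxk1 : xk1 = PΩ (xk - α • Fσ xk σk))
    (vk1 : Fin N × Fin n → ℝ)
    (hvk1 : vk1 = (W ⊗ₖ (1 : Matrix (Fin n) (Fin n) ℝ)).mulVec vk + xk1 - xk)
    (σk1 : Fin N × Fin n → ℝ)
    (hσk1 : σk1 = (W ⊗ₖ (1 : Matrix (Fin n) (Fin n) ℝ)).mulVec vk1) :
    -- the preconditioned forward-backward inclusion, componentwise: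
    (-(Fσ xk σk) + (1/2 : ℝ) • P.mulVec σk - (1/2 : ℝ) • P.mulVec σk1
        - α⁻¹ • (xk1 - xk) + (1/2 : ℝ) • P.mulVec (σk1 - σk)) ∈ normalCone Ωbig xk1 ∧
    -((1/2 : ℝ) • P.mulVec xk) = Ln.mulVec σk1 - (1/2 : ℝ) • P.mulVec xk1
        - (1/2 : ℝ) • P.mulVec (xk1 - xk) + P.mulVec (σk1 - σk) := by
  have hdet : IsUnit (1 + Dg).det := by
    have hdiag : 1 + Dg = Matrix.diagonal (fun i => 1 + ∑ j, E i j) := by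
      rw [hDg, ← Matrix.diagonal_one, Matrix.diagonal_add]
    rw [hdiag, Matrix.det_diagonal, isUnit_iff_ne_zero]
    refine Finset.prod_ne_zero_iff.mpr fun i _ => ?_
    have hdeg : 0 ≤ ∑ j, E i j := Finset.sum_nonneg fun j _ => by
      rcases hE01 i j with h | h <;> simp [h]
    positivity
  have hDW : (1 + Dg) * W = 1 + E := by
    rw [hW, Matrix.mul_nonsing_inv_cancel_left _ _ hdet]
  have hPk : P = (1 + E) ⊗ₖ (1 : Matrix (Fin n) (Fin n) ℝ) := by
    rw [hP, Matrix.add_kronecker, Matrix.one_kronecker_one]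
  have hLP : Ln + P = (1 + Dg) ⊗ₖ (1 : Matrix (Fin n) (Fin n) ℝ) := by
    rw [hLn, hPk, hL, ← Matrix.add_kronecker]
    congr 1
    abel
  have hbalance : Ln.mulVec σk1 + P.mulVec σk1 = P.mulVec σk + P.mulVec xk1 - P.mulVec xk := by
    rw [← Matrix.add_mulVec, hLP, hσk1, Matrix.mulVec_mulVec, ← Matrix.mul_kronecker_mul, hDW,
      one_mul, ← hPk, hvk1, ← hσk, Matrix.mulVec_sub, Matrix.mulVec_add]
  constructor
  · have hscale : -(Fσ xk σk) + (1/2 : ℝ) • P.mulVec σk - (1/2 : ℝ) • P.mulVec σk1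
        - α⁻¹ • (xk1 - xk) + (1/2 : ℝ) • P.mulVec (σk1 - σk)
        = α⁻¹ • (xk - α • Fσ xk σk - xk1) := by
      rw [Matrix.mulVec_sub, sub_right_comm xk, smul_sub _ (xk - xk1), inv_smul_smul₀ hα.ne']
      module
    intro z hz
    rw [hscale, smul_dotProduct, smul_eq_mul]
    refine mul_nonpos_of_nonneg_of_nonpos (inv_nonneg.mpr hα.le) ?_
    rw [hxk1]
    exact (hPΩ _).2 z hz
  · rw [eq_sub_of_add_eq hbalance, Matrix.mulVec_sub, Matrix.mulVec_sub]
    module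
end

section
/- Let H be a real inner product space and let T₁, T₂ : H → H be τ₁-averaged and τ₂-averaged, respectively, with τ₁, τ₂ ∈ (0,1). Then the composition T₁ ∘ T₂ is θ-averaged with θ := (τ₁ + τ₂ − 2τ₁τ₂)/(1 − τ₁τ₂) ∈ (0,1): for all x, y ∈ H, ‖T₁(T₂(x)) − T₁(T₂(y))‖² ≤ ‖x − y‖² − ((1−θ)/θ)·‖(x − T₁(T₂(x))) − (y − T₁(T₂(y)))‖². -/
/-- Weighted parallelogram inequality: `a * b / (a + b)` is the best constant `c` such that
`c * ‖u + v‖ ^ 2 ≤ a * ‖u‖ ^ 2 + b * ‖v‖ ^ 2`. -/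
theorem mul_div_add_mul_norm_add_sq_le {H : Type*} [NormedAddCommGroup H]
    [InnerProductSpace ℝ H] {a b : ℝ} (hab : 0 < a + b) (u v : H) :
    a * b / (a + b) * ‖u + v‖ ^ 2 ≤ a * ‖u‖ ^ 2 + b * ‖v‖ ^ 2 := by
  have h : 0 ≤ ‖a • u - b • v‖ ^ 2 := sq_nonneg _
  rw [norm_sub_sq_real, norm_smul, norm_smul, real_inner_smul_left, real_inner_smul_right,
    mul_pow, mul_pow, Real.norm_eq_abs, Real.norm_eq_abs, sq_abs, sq_abs] at h
  rw [norm_add_sq_real, div_mul_eq_mul_div, div_le_iff₀ hab]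
  linarith

/-- the composition of a `τ₁`-averaged and a `τ₂`-averaged map is
`θ`-averaged with `θ = (τ₁ + τ₂ − 2τ₁τ₂)/(1 − τ₁τ₂)`. -/
theorem composition_of_averaged_is_averaged
    {H : Type*} [NormedAddCommGroup H] [InnerProductSpace ℝ H]
    (τ₁ τ₂ : ℝ) (hτ₁ : τ₁ ∈ Set.Ioo (0 : ℝ) 1) (hτ₂ : τ₂ ∈ Set.Ioo (0 : ℝ) 1)
    (T₁ T₂ : H → H)
    (hT₁ : ∀ x y, ‖T₁ x - T₁ y‖ ^ 2 ≤
      ‖x - y‖ ^ 2 - ((1 - τ₁) / τ₁) * ‖(x - T₁ x) - (y - T₁ y)‖ ^ 2)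
    (hT₂ : ∀ x y, ‖T₂ x - T₂ y‖ ^ 2 ≤
      ‖x - y‖ ^ 2 - ((1 - τ₂) / τ₂) * ‖(x - T₂ x) - (y - T₂ y)‖ ^ 2)
    (θ : ℝ) (hθ : θ = (τ₁ + τ₂ - 2 * τ₁ * τ₂) / (1 - τ₁ * τ₂)) :
    θ ∈ Set.Ioo (0 : ℝ) 1 ∧
    ∀ x y, ‖T₁ (T₂ x) - T₁ (T₂ y)‖ ^ 2 ≤
      ‖x - y‖ ^ 2 - ((1 - θ) / θ) * ‖(x - T₁ (T₂ x)) - (y - T₁ (T₂ y))‖ ^ 2 := by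
  obtain ⟨h₁, h₁'⟩ := hτ₁
  obtain ⟨h₂, h₂'⟩ := hτ₂
  have p₁ : 0 < 1 - τ₁ := sub_pos.2 h₁'
  have p₂ : 0 < 1 - τ₂ := sub_pos.2 h₂'
  have hnum : 0 < τ₁ + τ₂ - 2 * τ₁ * τ₂ := by
    linarith [mul_pos h₁ p₂, mul_pos h₂ p₁]
  have hden : 0 < 1 - τ₁ * τ₂ := by
    linarith [mul_pos h₁ p₂]
  refine ⟨⟨hθ ▸ div_pos hnum hden, ?_⟩, fun x y ↦ ?_⟩
  · rw [hθ, div_lt_one hden]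
    linarith [mul_pos p₁ p₂]
  have hab : 0 < (1 - τ₁) / τ₁ + (1 - τ₂) / τ₂ := by positivity
  have hc : (1 - θ) / θ =
      (1 - τ₁) / τ₁ * ((1 - τ₂) / τ₂) / ((1 - τ₁) / τ₁ + (1 - τ₂) / τ₂) := by
    have hsum : (1 - τ₁) / τ₁ + (1 - τ₂) / τ₂ = (τ₁ + τ₂ - 2 * τ₁ * τ₂) / (τ₁ * τ₂) := by
      field_simp
      ring
    have hθ' : 1 - θ = (1 - τ₁) * (1 - τ₂) / (1 - τ₁ * τ₂) := by
      rw [hθ, eq_div_iff hden.ne', sub_mul, div_mul_cancel₀ _ hden.ne']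
      ring
    rw [hsum, hθ', hθ, div_div_div_cancel_right₀ hden.ne', div_mul_div_comm,
      div_div_div_cancel_right₀ (mul_pos h₁ h₂).ne']
  have key := mul_div_add_mul_norm_add_sq_le hab
    ((T₂ x - T₁ (T₂ x)) - (T₂ y - T₁ (T₂ y))) ((x - T₂ x) - (y - T₂ y))
  have huv : (T₂ x - T₁ (T₂ x)) - (T₂ y - T₁ (T₂ y)) + ((x - T₂ x) - (y - T₂ y)) =
      (x - T₁ (T₂ x)) - (y - T₁ (T₂ y)) := by abel
  rw [huv, ← hc] at key
  linarith [hT₁ (T₂ x) (T₂ y), hT₂ x y]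
end
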